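/- arXiv:1610.09745 — 2 statements merged into one kernel-verified Lean document; each statement's English description precedes it below -/
import Mathlib

section
/- Let n ≥ 2 and M ≥ 1 be integers, let a = (a_1,…,a_M) and b = (b_1,…,b_M) be two distinct elements of V, and set L = #{k ∈ {1,…,M} : a_k ≠ b_k} (so 1 ≤ L ≤ M). If h : V → ℝ is the hitting-time solution for the target vertex b, then h(a) = ∑_{k=M−L}^{M−1} ((n−1)^{k+1}/C(M−1,k)) · ∑_{ℓ=0}^{k} C(M,ℓ)/(n−1)^{ℓ}, where C(n,m) denotes the binomial coefficient. -/
open Finset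

/-- `h` is the hitting-time solution for target `b` of the symmetric nearest-neighbor
random walk on the Hamming graph `{1,…,n}^M` (vertices differ in exactly one coordinate). -/
def IsHitSol {M n : ℕ} (b : Fin M → Fin n) (h : (Fin M → Fin n) → ℝ) : Prop :=
  h b = 0 ∧ ∀ x, x ≠ b →
    h x = 1 + (1 / (((n : ℝ) - 1) * M)) *
      ∑ y ∈ univ.filter (fun y => hammingDist x y = 1), h y

theorem hammingDist_eq_one_iff {M n : ℕ} (x y : Fin M → Fin n) :
    hammingDist x y = 1 ↔ ∃ i c, c ≠ x i ∧ y = Function.update x i c := by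
  constructor
  · intro hxy
    obtain ⟨i, hi⟩ := Finset.card_eq_one.mp hxy
    have hmem : ∀ j, x j ≠ y j ↔ j = i := fun j => by
      simpa using Finset.ext_iff.mp hi j
    refine ⟨i, y i, Ne.symm ((hmem i).2 rfl), ?_⟩
    funext j
    by_cases hj : j = i
    · subst hj; simp
    · rw [Function.update_of_ne hj]
      by_contra hne
      exact hj ((hmem j).1 (Ne.symm hne))
  · rintro ⟨i, c, hc, rfl⟩
    refine Finset.card_eq_one.mpr ⟨i, ?_⟩
    ext j
    by_cases hj : j = i
    · subst hj; simpa using hc.symm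
    · simp [hj]

/-- Neighbors in the Hamming graph are parametrized by the changed coordinate and its new value. -/
theorem sum_hammingDist_eq_one {M n : ℕ} (x : Fin M → Fin n) (F : (Fin M → Fin n) → ℝ) :
    ∑ y ∈ univ.filter (fun y => hammingDist x y = 1), F y =
      ∑ i, ∑ c ∈ univ.erase (x i), F (Function.update x i c) := by
  rw [Finset.sum_sigma']
  symm
  refine Finset.sum_bij (fun p _ => Function.update x p.1 p.2) ?_ ?_ ?_ ?_
  · rintro ⟨i, c⟩ hp
    simp only [mem_sigma, mem_univ, mem_erase, true_and, and_true] at hp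
    simp only [mem_filter, mem_univ, true_and]
    exact (hammingDist_eq_one_iff _ _).2 ⟨i, c, hp, rfl⟩
  · rintro ⟨i, c⟩ hp ⟨j, d⟩ hq heq
    simp only [mem_sigma, mem_univ, mem_erase, true_and, and_true] at hp hq
    simp only at heq
    have hij : i = j := by
      by_contra hij
      have := congrFun heq i
      rw [Function.update_self, Function.update_of_ne hij] at this
      exact hp this
    subst hij
    have := congrFun heq i
    simp only [Function.update_self] at this
    rw [this]
  · intro y hy
    simp only [mem_filter, mem_univ, true_and] at hy
    obtain ⟨i, c, hc, rfl⟩ := (hammingDist_eq_one_iff _ _).1 hy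
    exact ⟨⟨i, c⟩, by simpa using hc, rfl⟩
  · intros; rfl

/-- The unnormalized Laplacian of the Hamming graph. -/
def hammingLap {M n : ℕ} (F : (Fin M → Fin n) → ℝ) (x : Fin M → Fin n) : ℝ :=
  ∑ i, ∑ c, (F x - F (Function.update x i c))

theorem IsHitSol.hammingLap_eq {M n : ℕ} (hn : 2 ≤ n) (hM : 1 ≤ M) {b : Fin M → Fin n}
    {h : (Fin M → Fin n) → ℝ} (hsol : IsHitSol b h) {x : Fin M → Fin n} (hx : x ≠ b) :
    hammingLap h x = ((n : ℝ) - 1) * M := by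
  have hn' : (2 : ℝ) ≤ n := by exact_mod_cast hn
  have hM' : (1 : ℝ) ≤ M := by exact_mod_cast hM
  have hpos : 0 < ((n : ℝ) - 1) * M := mul_pos (by linarith) (by linarith)
  have heq := hsol.2 x hx
  rw [sum_hammingDist_eq_one] at heq
  have hinner : ∀ i, ∑ c, (h x - h (Function.update x i c)) =
      ((n : ℝ) - 1) * h x - ∑ c ∈ univ.erase (x i), h (Function.update x i c) := by
    intro i
    rw [← Finset.add_sum_erase _ _ (mem_univ (x i)), Function.update_eq_self,
      Finset.sum_sub_distrib, Finset.sum_const, Finset.card_erase_of_mem (mem_univ _),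
      Finset.card_univ, Fintype.card_fin, nsmul_eq_mul, Nat.cast_sub (by omega)]
    push_cast
    ring
  rw [hammingLap, Finset.sum_congr rfl (fun i _ => hinner i), Finset.sum_sub_distrib,
    Finset.sum_const, Finset.card_univ, Fintype.card_fin, nsmul_eq_mul]
  set S := ∑ i, ∑ c ∈ univ.erase (x i), h (Function.update x i c)
  linear_combination (((n : ℝ) - 1) * M) * heq + S * mul_one_div_cancel hpos.ne'

theorem hammingDist_update {M n : ℕ} (x b : Fin M → Fin n) (i : Fin M) (c : Fin n) :
    hammingDist (Function.update x i c) b + (if x i ≠ b i then 1 else 0) =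
      hammingDist x b + (if c ≠ b i then 1 else 0) := by
  simp only [hammingDist, Finset.card_filter]
  rw [← Finset.add_sum_erase _ _ (mem_univ i),
    ← Finset.add_sum_erase univ (fun j => if x j ≠ b j then 1 else 0) (mem_univ i),
    Function.update_self, Finset.sum_congr rfl (fun j hj => by
      rw [Function.update_of_ne (Finset.ne_of_mem_erase hj)])]
  ring

/-- Maximum principle: a function harmonic off `b` is bounded by its value at `b`. -/
theorem le_of_hammingLap_eq_zero {M n : ℕ} {b : Fin M → Fin n} {g : (Fin M → Fin n) → ℝ}
    (hg : ∀ x, x ≠ b → hammingLap g x = 0) (x : Fin M → Fin n) : g x ≤ g b := by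
  obtain ⟨m, -, hm⟩ := Finset.exists_max_image univ g ⟨b, mem_univ b⟩
  have key : ∀ d : ℕ, ∀ z, hammingDist z b = d → (∀ y, g y ≤ g z) → g z = g b := by
    intro d
    induction d with
    | zero => intro z hz _; rw [hammingDist_eq_zero.mp hz]
    | succ d ih =>
      intro z hz hmax
      have hzb : z ≠ b := by rintro rfl; simp at hz
      obtain ⟨i, hi⟩ := Function.ne_iff.mp hzb
      have h1 := (Finset.sum_eq_zero_iff_of_nonneg (fun i _ => Finset.sum_nonneg
        (fun c _ => sub_nonneg.2 (hmax (Function.update z i c))))).1 (hg z hzb) i (mem_univ i)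
      have h2 := (Finset.sum_eq_zero_iff_of_nonneg
        (fun c _ => sub_nonneg.2 (hmax (Function.update z i c)))).1 h1 (b i) (mem_univ _)
      have hd := hammingDist_update z b i (b i)
      simp only [hi, ne_eq, not_false_eq_true, if_true, not_true_eq_false, if_false] at hd
      rw [sub_eq_zero.mp h2]
      exact ih _ (by omega) (fun y => by rw [← sub_eq_zero.mp h2]; exact hmax y)
  rw [← key _ m rfl (fun y => hm y (mem_univ y))]
  exact hm x (mem_univ x)

theorem hammingLap_sub {M n : ℕ} (F G : (Fin M → Fin n) → ℝ) (x : Fin M → Fin n) :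
    hammingLap (fun y => F y - G y) x = hammingLap F x - hammingLap G x := by
  simp only [hammingLap, ← Finset.sum_sub_distrib]
  refine Finset.sum_congr rfl fun i _ => Finset.sum_congr rfl fun c _ => by ring

/-- The Laplacian of a function of the distance to `b`. -/
theorem hammingLap_radial {M n : ℕ} (b x : Fin M → Fin n) (f : ℕ → ℝ) :
    hammingLap (fun y => f (hammingDist y b)) x =
      hammingDist x b * (f (hammingDist x b) - f (hammingDist x b - 1)) -
      ((M : ℝ) - hammingDist x b) * (((n : ℝ) - 1) *
        (f (hammingDist x b + 1) - f (hammingDist x b))) := by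
  have hinner : ∀ i, ∑ c, (f (hammingDist x b) - f (hammingDist (Function.update x i c) b)) =
      if x i ≠ b i then f (hammingDist x b) - f (hammingDist x b - 1)
      else -(((n : ℝ) - 1) * (f (hammingDist x b + 1) - f (hammingDist x b))) := by
    intro i
    split_ifs with hi
    · rw [Finset.sum_eq_single (b i)]
      · have hd := hammingDist_update x b i (b i)
        simp only [hi, ne_eq, not_false_eq_true, if_true, not_true_eq_false, if_false] at hd
        congr 2
        omega
      · intro c _ hc
        have hd := hammingDist_update x b i c
        simp only [hi, hc, ne_eq, not_false_eq_true, if_true] at hd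
        rw [show hammingDist (Function.update x i c) b = hammingDist x b by omega, sub_self]
      · simp
    · have hi' : x i = b i := not_not.mp hi
      have hn : 1 ≤ n := (b i).pos
      rw [← Finset.add_sum_erase _ _ (mem_univ (x i)), Function.update_eq_self, sub_self,
        zero_add, Finset.sum_congr rfl (g := fun _ =>
          f (hammingDist x b) - f (hammingDist x b + 1)), Finset.sum_const,
        Finset.card_erase_of_mem (mem_univ _), Finset.card_univ, Fintype.card_fin, nsmul_eq_mul,
        Nat.cast_sub hn]
      · push_cast
        ring
      · intro c hc
        have hc' : c ≠ b i := hi' ▸ Finset.ne_of_mem_erase hc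
        have hd := hammingDist_update x b i c
        simp only [hi', hc', ne_eq, not_false_eq_true, if_true, not_true_eq_false, if_false] at hd
        rw [show hammingDist (Function.update x i c) b = hammingDist x b + 1 by omega]
  have hcard : ((univ.filter (fun i => ¬ x i ≠ b i)).card : ℝ) = (M : ℝ) - hammingDist x b := by
    have := Finset.card_filter_add_card_filter_not (s := univ) (fun i => x i ≠ b i)
    rw [Finset.card_univ, Fintype.card_fin] at this
    rw [eq_sub_iff_add_eq, add_comm]
    exact_mod_cast this
  rw [hammingLap, Finset.sum_congr rfl (fun i _ => hinner i), Finset.sum_ite, Finset.sum_const,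
    Finset.sum_const, nsmul_eq_mul, nsmul_eq_mul, hcard]
  simp only [hammingDist]
  ring

/-- The expected time to get from distance `M - k` to distance `M - k - 1` from the target,
with `q = n - 1`. -/
noncomputable def hitIncrement (q : ℝ) (M k : ℕ) : ℝ :=
  (q ^ (k + 1) / ((M - 1).choose k : ℝ)) * ∑ ℓ ∈ Finset.range (k + 1), (M.choose ℓ : ℝ) / q ^ ℓ

theorem hitIncrement_zero (q : ℝ) (M : ℕ) : hitIncrement q M 0 = q := by
  simp [hitIncrement]

theorem hitIncrement_succ {q : ℝ} (hq : q ≠ 0) {M k : ℕ} (hk : k + 1 < M) :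
    ((M : ℝ) - (k + 1)) * hitIncrement q M (k + 1) =
      (k + 1) * q * hitIncrement q M k + q * M := by
  obtain ⟨N, rfl⟩ : ∃ N, M = N + 1 := ⟨M - 1, by omega⟩
  have hkN : k + 1 ≤ N := by omega
  have h0 : ((N.choose k : ℕ) : ℝ) ≠ 0 := by
    exact_mod_cast (Nat.choose_pos (by omega : k ≤ N)).ne'
  have h1 : ((N.choose (k + 1) : ℕ) : ℝ) ≠ 0 := by
    exact_mod_cast (Nat.choose_pos hkN).ne'
  have e1 : (N.choose (k + 1) : ℝ) * (k + 1) = N.choose k * ((N : ℝ) - k) := by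
    have := Nat.choose_succ_right_eq N k
    rw [← Nat.cast_sub (by omega : k ≤ N)]
    exact_mod_cast this
  have e2 : ((N + 1 : ℝ)) * N.choose k = (N + 1).choose (k + 1) * (k + 1) := by
    exact_mod_cast Nat.add_one_mul_choose_eq N k
  simp only [hitIncrement, Nat.add_sub_cancel]
  rw [Finset.sum_range_succ _ (k + 1)]
  set S := ∑ ℓ ∈ Finset.range (k + 1), ((N + 1).choose ℓ : ℝ) / q ^ ℓ
  have e3 : ((N : ℝ) - k) / N.choose (k + 1) = (k + 1) / N.choose k := by
    rw [div_eq_div_iff h1 h0]; linarith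
  have e4 : (k + 1 : ℝ) / N.choose k * (N + 1).choose (k + 1) = N + 1 := by
    rw [div_mul_eq_mul_div, div_eq_iff h0]; linarith
  calc (((N + 1 : ℕ) : ℝ) - (k + 1)) * (q ^ (k + 1 + 1) / N.choose (k + 1) *
        (S + ((N + 1).choose (k + 1) : ℝ) / q ^ (k + 1)))
      = ((N : ℝ) - k) / N.choose (k + 1) * q ^ (k + 2) *
        (S + ((N + 1).choose (k + 1) : ℝ) / q ^ (k + 1)) := by push_cast; ring
    _ = (k + 1) / N.choose k * q ^ (k + 2) * S +
        q * ((k + 1) / N.choose k * (N + 1).choose (k + 1)) := by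
      rw [e3]; field_simp; ring
    _ = _ := by rw [e4]; push_cast; ring

theorem sum_Icc_hitIncrement_succ (q : ℝ) {M L : ℕ} (hL : L < M) :
    ∑ k ∈ Finset.Icc (M - (L + 1)) (M - 1), hitIncrement q M k =
      hitIncrement q M (M - (L + 1)) + ∑ k ∈ Finset.Icc (M - L) (M - 1), hitIncrement q M k := by
  rw [← Finset.add_sum_Ioc_eq_sum_Icc (by omega)]
  congr 1
  refine Finset.sum_congr ?_ fun _ _ => rfl
  ext k
  simp only [mem_Ioc, mem_Icc]
  omega

theorem hammingLap_sum_hitIncrement {M n : ℕ} (hn : 2 ≤ n) {b x : Fin M → Fin n} (hx : x ≠ b) :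
    hammingLap (fun y => ∑ k ∈ Finset.Icc (M - hammingDist y b) (M - 1),
      hitIncrement ((n : ℝ) - 1) M k) x = ((n : ℝ) - 1) * M := by
  have hn' : (2 : ℝ) ≤ n := by exact_mod_cast hn
  have hq : (n : ℝ) - 1 ≠ 0 := by linarith
  rw [hammingLap_radial b x
    (fun L => ∑ k ∈ Finset.Icc (M - L) (M - 1), hitIncrement ((n : ℝ) - 1) M k)]
  have hle : hammingDist x b ≤ M := by simpa using hammingDist_le_card_fintype (x := x) (y := b)
  obtain ⟨d, hd⟩ : ∃ d, hammingDist x b = d + 1 :=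
    Nat.exists_eq_succ_of_ne_zero (hammingDist_ne_zero.mpr hx)
  rw [hd] at hle ⊢
  have hs := sum_Icc_hitIncrement_succ ((n : ℝ) - 1) (show d < M by omega)
  simp only [Nat.add_sub_cancel]
  rcases hle.eq_or_lt with hM | hlt
  · subst hM
    rw [hs, Nat.sub_self, hitIncrement_zero]
    push_cast
    ring
  · obtain ⟨k, rfl⟩ : ∃ k, M = d + 1 + (k + 1) := ⟨M - (d + 2), by omega⟩
    have hs' := sum_Icc_hitIncrement_succ ((n : ℝ) - 1) hlt
    have hr := hitIncrement_succ hq (show k + 1 < d + 1 + (k + 1) by omega)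
    rw [hs', hs]
    rw [show d + 1 + (k + 1) - (d + 1) = k + 1 by omega,
      show d + 1 + (k + 1) - (d + 1 + 1) = k by omega]
    push_cast at hr ⊢
    linear_combination hr

theorem stmt_1 (n M : ℕ) (hn : 2 ≤ n) (hM : 1 ≤ M)
    (a b : Fin M → Fin n) (hab : a ≠ b)
    (L : ℕ) (hL : L = (univ.filter (fun k => a k ≠ b k)).card)
    (h : (Fin M → Fin n) → ℝ)
    (hsol : IsHitSol b h) :
    h a = ∑ k ∈ Finset.Icc (M - L) (M - 1),
      (((n : ℝ) - 1) ^ (k + 1) / ((M - 1).choose k : ℝ)) *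
        ∑ ℓ ∈ Finset.range (k + 1), (M.choose ℓ : ℝ) / ((n : ℝ) - 1) ^ ℓ := by
  have hharm : ∀ x, x ≠ b → hammingLap h x - hammingLap (fun y =>
      ∑ k ∈ Finset.Icc (M - hammingDist y b) (M - 1), hitIncrement ((n : ℝ) - 1) M k) x = 0 :=
    fun x hx => by rw [hsol.hammingLap_eq hn hM hx, hammingLap_sum_hitIncrement hn hx, sub_self]
  have hempty : Finset.Icc M (M - 1) = ∅ := Finset.Icc_eq_empty (by omega)
  have h1 := le_of_hammingLap_eq_zero (b := b)
    (fun x hx => (hammingLap_sub _ _ x).trans (hharm x hx)) a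
  have h2 := le_of_hammingLap_eq_zero (b := b)
    (fun x hx => (hammingLap_sub _ _ x).trans
      ((neg_sub _ _).symm.trans (neg_eq_zero.mpr (hharm x hx)))) a
  simp only [hammingDist_self, Nat.sub_zero, hempty, Finset.sum_empty, hsol.1, sub_zero] at h1 h2
  subst hL
  exact le_antisymm (sub_nonpos.mp h1) (sub_nonpos.mp h2)
end

section
/- Let n ≥ 2 and k ≥ 2 be integers. If u : {1,…,2k} → ℝ is a harmonic solution for the lumped chain, then u(1) = (n^{k−1} − 1)/(n^k − 1), and consequently ((k−1)/k)·u(2k−2) = (n^{k−1} − 1)/(n^k − 1) as well. -/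
/-- Transition probabilities of the lumped chain on the states `{1,…,2k}`:
for `1 ≤ i ≤ k`,
`q(2i,2i−1) = 1/k`, `q(2i,2i−2) = (i−1)/k`, `q(2i,2i+2) = (k−i)/(k(n−1))`,
`q(2i,2i) = (k−i)(n−2)/(k(n−1))`, `q(2i−1,2i) = 1/(k(n−1))`,
`q(2i−1,2i+1) = (k−i)/(k(n−1))`, `q(2i−1,2i−3) = (i−1)/k`,
`q(2i−1,2i−1) = (k−i+1)(n−2)/(k(n−1))`, and `q(m,m′) = 0` otherwise. -/
noncomputable def lumpedQ (n k : ℕ) (m m' : ℕ) : ℝ :=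
  if m % 2 = 0 then
    let i := m / 2
    if m' = 2 * i - 1 then 1 / (k : ℝ)
    else if m' = 2 * i - 2 then ((i : ℝ) - 1) / (k : ℝ)
    else if m' = 2 * i + 2 then ((k : ℝ) - (i : ℝ)) / ((k : ℝ) * ((n : ℝ) - 1))
    else if m' = 2 * i then ((k : ℝ) - (i : ℝ)) * ((n : ℝ) - 2) / ((k : ℝ) * ((n : ℝ) - 1))
    else 0
  else
    let i := (m + 1) / 2
    if m' = 2 * i then 1 / ((k : ℝ) * ((n : ℝ) - 1))
    else if m' = 2 * i + 1 then ((k : ℝ) - (i : ℝ)) / ((k : ℝ) * ((n : ℝ) - 1))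
    else if m' = 2 * i - 3 then ((i : ℝ) - 1) / (k : ℝ)
    else if m' = 2 * i - 1 then
      ((k : ℝ) - (i : ℝ) + 1) * ((n : ℝ) - 2) / ((k : ℝ) * ((n : ℝ) - 1))
    else 0

/-- `u` is a harmonic solution for the lumped chain: `u(2k−1) = 0`, `u(2k) = 1`, and
`u(m) = ∑_{m'=1}^{2k} q(m,m')·u(m')` for every `1 ≤ m ≤ 2k−2`; `u(m)` is the probability
of hitting state `2k` before state `2k−1` starting from `m`. -/
def IsHarmonicSol (n k : ℕ) (u : ℕ → ℝ) : Prop :=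
  u (2 * k - 1) = 0 ∧ u (2 * k) = 1 ∧
    ∀ m, 1 ≤ m → m ≤ 2 * k - 2 →
      u m = ∑ m' ∈ Finset.Icc 1 (2 * k), lumpedQ n k m m' * u m'

/-- A sum against a weight supported on four distinct points, where the second and
third points may lie outside the range of summation if their weights vanish. -/
lemma sum_four_point_weight_mul (S : Finset ℕ) (v : ℕ → ℝ) {p q r s : ℕ} (A B C D : ℝ)
    (hp : p ∈ S) (hq : q ∈ S ∨ B = 0) (hr : r ∈ S ∨ C = 0) (hs : s ∈ S)
    (hpq : p ≠ q) (hpr : p ≠ r) (hps : p ≠ s) (hqr : q ≠ r) (hqs : q ≠ s) (hrs : r ≠ s) :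
    ∑ m ∈ S, (if m = p then A else if m = q then B else if m = r then C
      else if m = s then D else 0) * v m = A * v p + B * v q + C * v r + D * v s := by
  have h : ∀ m ∈ S, (if m = p then A else if m = q then B else if m = r then C
      else if m = s then D else 0) * v m =
      (if m = p then A * v p else 0) + (if m = q then B * v q else 0) +
      (if m = r then C * v r else 0) + (if m = s then D * v s else 0) := by
    intro m _
    split_ifs <;> subst_vars <;> simp_all
  rw [Finset.sum_congr rfl h]
  simp only [Finset.sum_add_distrib, Finset.sum_ite_eq', hp, hs, if_true]
  rcases hq with hq | hq <;> rcases hr with hr | hr <;> simp [hq, hr]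

lemma IsHarmonicSol.even_eq {n k : ℕ} {u : ℕ → ℝ} (hu : IsHarmonicSol n k u) (hn : 2 ≤ n)
    {i : ℕ} (hi : 1 ≤ i) (hik : i + 1 ≤ k) :
    ((n : ℝ) - 1) * (u (2 * i - 1) - u (2 * i))
      + ((n : ℝ) - 1) * ((i : ℝ) - 1) * (u (2 * i - 2) - u (2 * i))
      + ((k : ℝ) - i) * (u (2 * i + 2) - u (2 * i)) = 0 := by
  have h := hu.2.2 (2 * i) (by omega) (by omega)
  have h0 : 2 * i % 2 = 0 := by omega
  have h1 : 2 * i / 2 = i := by omega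
  simp only [lumpedQ, h0, h1, if_true] at h
  rw [sum_four_point_weight_mul] at h
  · have hk0 : (k : ℝ) ≠ 0 := by
      have : k ≠ 0 := by omega
      exact_mod_cast this
    have hn0 : (n : ℝ) - 1 ≠ 0 := by
      have : (2 : ℝ) ≤ n := by exact_mod_cast hn
      linarith
    field_simp at h
    linear_combination -h
  · simp; omega
  · rcases hi.eq_or_lt with rfl | hi
    · right; simp
    · left; simp; omega
  · left; simp; omega
  · simp; omega
  all_goals omega

lemma IsHarmonicSol.odd_eq {n k : ℕ} {u : ℕ → ℝ} (hu : IsHarmonicSol n k u) (hn : 2 ≤ n)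
    {i : ℕ} (hi : 1 ≤ i) (hik : i + 1 ≤ k) :
    (u (2 * i) - u (2 * i - 1)) + ((k : ℝ) - i) * (u (2 * i + 1) - u (2 * i - 1))
      + ((n : ℝ) - 1) * ((i : ℝ) - 1) * (u (2 * i - 3) - u (2 * i - 1)) = 0 := by
  have h := hu.2.2 (2 * i - 1) (by omega) (by omega)
  have h0 : (2 * i - 1) % 2 = 1 := by omega
  have h1 : (2 * i - 1 + 1) / 2 = i := by omega
  simp only [lumpedQ, h0, h1, one_ne_zero, if_false] at h
  rw [sum_four_point_weight_mul] at h
  · have hk0 : (k : ℝ) ≠ 0 := by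
      have : k ≠ 0 := by omega
      exact_mod_cast this
    have hn0 : (n : ℝ) - 1 ≠ 0 := by
      have : (2 : ℝ) ≤ n := by exact_mod_cast hn
      linarith
    field_simp at h
    linear_combination -h
  · simp; omega
  · left; simp; omega
  · rcases hi.eq_or_lt with rfl | hi
    · right; simp
    · left; simp; omega
  · simp; omega
  all_goals omega

/-- The partial sums `∑_{j < x} C(N, j) r^{x-1-j}`, defined by their Horner recursion. -/
def hornerChoose (r : ℝ) (N : ℕ) : ℕ → ℝ
  | 0 => 0
  | x + 1 => r * hornerChoose r N x + N.choose x

lemma hornerChoose_eq_sum (r : ℝ) (N x : ℕ) :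
    hornerChoose r N (x + 1) = ∑ j ∈ Finset.range (x + 1), r ^ (x - j) * N.choose j := by
  induction x with
  | zero => simp [hornerChoose]
  | succ x ih =>
    rw [hornerChoose, ih, Finset.sum_range_succ _ (x + 1), Finset.mul_sum]
    simp only [Nat.sub_self, pow_zero, one_mul, add_left_inj]
    refine Finset.sum_congr rfl fun j hj => ?_
    rw [Nat.succ_sub (Finset.mem_range_succ_iff.1 hj), pow_succ]
    ring

lemma hornerChoose_self_succ (r : ℝ) (N : ℕ) : hornerChoose r N (N + 1) = (r + 1) ^ N := by
  rw [hornerChoose_eq_sum, add_comm r 1, add_pow]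
  simp

lemma cast_succ_mul_choose_succ {N x : ℕ} (hx : x ≤ N) :
    ((x : ℝ) + 1) * N.choose (x + 1) = ((N : ℝ) - x) * N.choose x := by
  have h := Nat.choose_succ_right_eq N x
  rw [← Nat.cast_sub hx]
  have hcast : (N.choose (x + 1) : ℝ) * ((x + 1 : ℕ) : ℝ) = N.choose x * ((N - x : ℕ) : ℝ) := by
    exact_mod_cast h
  push_cast at hcast
  linarith

/-- The solution at states `2x+1` and `2x+2` in terms of its values at states `1` and `2`. -/
lemma IsHarmonicSol.choose_mul_eq {n N : ℕ} {u : ℕ → ℝ} (hu : IsHarmonicSol n (N + 1) u)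
    (hn : 2 ≤ n) {x : ℕ} (hx : x ≤ N) :
    (N.choose x : ℝ) * u (2 * x + 1)
        = N.choose x * u 1 - (u 2 - u 1) * hornerChoose ((n : ℝ) - 1) N x ∧
      (N.choose x : ℝ) * u (2 * x + 2)
        = N.choose x * u 1 + (u 2 - u 1) * hornerChoose ((n : ℝ) - 1) N (x + 1) := by
  induction x using Nat.twoStepInduction with
  | zero => simp [hornerChoose]
  | one =>
    have he := hu.even_eq hn (i := 1) le_rfl (by omega)
    have ho := hu.odd_eq hn (i := 1) le_rfl (by omega)
    norm_num at he ho
    simp only [hornerChoose, Nat.choose_zero_right, Nat.choose_one_right]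
    push_cast
    constructor
    · norm_num
      linear_combination ho
    · norm_num
      linear_combination he
  | more y ih0 ih1 =>
    obtain ⟨a0, b0⟩ := ih0 (by omega)
    obtain ⟨a1, b1⟩ := ih1 (by omega)
    have he := hu.even_eq hn (i := y + 2) (by omega) (by omega)
    have ho := hu.odd_eq hn (i := y + 2) (by omega) (by omega)
    have c0 := cast_succ_mul_choose_succ (N := N) (x := y) (by omega)
    have c1 := cast_succ_mul_choose_succ (N := N) (x := y + 1) (by omega)
    simp only [show 2 * (y + 2) = 2 * y + 4 by omega,
      show 2 * (y + 1) = 2 * y + 2 by omega, add_assoc, Nat.reduceAdd, hornerChoose]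
      at he ho a0 a1 b0 b1 c0 c1 ⊢
    push_cast at he ho c0 c1
    have hy : (y : ℝ) + 2 ≠ 0 := by positivity
    constructor
    · apply mul_left_cancel₀ hy
      linear_combination (u (2 * y + 5) - u 1) * c1 + (N.choose (y + 1) : ℝ) * ho - b1
        + (1 + ((N : ℝ) - y - 1) + ((n : ℝ) - 1) * (y + 1)) * a1
        - ((n : ℝ) - 1) * (u (2 * y + 1) - u 1) * c0 - ((n : ℝ) - 1) * ((N : ℝ) - y) * a0
        + (u 2 - u 1) * c0
    · apply mul_left_cancel₀ hy
      linear_combination (u (2 * y + 6) - u 1) * c1 + (N.choose (y + 1) : ℝ) * he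
        - ((n : ℝ) - 1) * a1
        + (((n : ℝ) - 1) + ((N : ℝ) - y - 1) + ((n : ℝ) - 1) * (y + 1)) * b1
        - ((n : ℝ) - 1) * (u (2 * y + 2) - u 1) * c0 - ((n : ℝ) - 1) * ((N : ℝ) - y) * b0
        - (u 2 - u 1) * c1

theorem stmt_16 (n k : ℕ) (hn : 2 ≤ n) (hk : 2 ≤ k)
    (u : ℕ → ℝ) (hu : IsHarmonicSol n k u) :
    u 1 = ((n : ℝ) ^ (k - 1) - 1) / ((n : ℝ) ^ k - 1) ∧
    (((k : ℝ) - 1) / (k : ℝ)) * u (2 * k - 2) =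
      ((n : ℝ) ^ (k - 1) - 1) / ((n : ℝ) ^ k - 1) := by
  obtain ⟨M, rfl⟩ : ∃ M, k = M + 2 := ⟨k - 2, by omega⟩
  obtain ⟨ha, hb⟩ := hu.choose_mul_eq hn (x := M + 1) le_rfl
  obtain ⟨-, hc⟩ := hu.choose_mul_eq hn (x := M) (by omega)
  have h0 : u (2 * (M + 1) + 1) = 0 := hu.1
  have h1 : u (2 * (M + 1) + 2) = 1 := hu.2.1
  have hT := hornerChoose_self_succ ((n : ℝ) - 1) (M + 1)
  rw [hT, h1] at hb
  rw [hornerChoose] at hT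
  rw [h0] at ha
  simp only [Nat.choose_self, Nat.choose_succ_self_right, sub_add_cancel] at ha hb hc hT
  have hn2 : (2 : ℝ) ≤ n := by exact_mod_cast hn
  have hpos : (n : ℝ) ^ (M + 2) - 1 ≠ 0 := by
    have := one_lt_pow₀ (by linarith : (1 : ℝ) < n) (by omega : M + 2 ≠ 0)
    linarith
  have hmain : u 1 = ((n : ℝ) ^ (M + 1) - 1) / ((n : ℝ) ^ (M + 2) - 1) := by
    rw [eq_div_iff hpos]
    have hd : (u 2 - u 1) * ((n : ℝ) ^ (M + 2) - 1) = n - 1 := by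
      linear_combination ((n : ℝ) - 1) * (ha - hb) - (u 2 - u 1) * hT
    linear_combination (-((n : ℝ) ^ (M + 2) - 1)) * hb - (n : ℝ) ^ (M + 1) * hd
  rw [show M + 2 - 1 = M + 1 by omega]
  refine ⟨hmain, ?_⟩
  rw [← hmain, show 2 * (M + 2) - 2 = 2 * M + 2 by omega]
  have hM : ((M : ℝ) + 2) ≠ 0 := by positivity
  push_cast at hc ⊢
  field_simp
  linear_combination hc + ha
end
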